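/- arXiv:1702.01128 — 10 statements merged into one kernel-verified Lean document; each statement's English description precedes it below -/
import Mathlib

section
/- Let q : ℝ → (0,∞) be continuously differentiable, λ ∈ ℂ, and let Φ : ℝ → ℂ² satisfy Φ_x = 𝓛Φ with 𝓛 = [[-1/2, λ],[λq, 1/2]]. Define G = diag(q^{-1/4}, q^{1/4}) and Ψ := G^{-1}Φ. Then Ψ satisfies Ψ_x + (h̃σ₃ − λ√q J)Ψ = 0, where h̃ = 1/2 − q_x/(4q), σ₃ = diag(1,−1) and J = [[0,1],[1,0]]. -/
open Matrix

theorem inv_fin_two_diagonal {K : Type*} [Field K] {a b : K} (h : a * b = 1) :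
    (!![a, 0; 0, b])⁻¹ = !![b, 0; 0, a] := by
  apply Matrix.inv_eq_right_inv
  ext i j
  fin_cases i <;> fin_cases j <;> simp [h, mul_comm b a]

theorem hasDerivAt_ofReal_rpow_const {q : ℝ → ℝ} {q' x : ℝ} (hq : HasDerivAt q q' x)
    (hpos : 0 < q x) (p : ℝ) :
    HasDerivAt (fun y => ((q y ^ p : ℝ) : ℂ))
      ((p : ℂ) * (q' / q x) * ((q x ^ p : ℝ) : ℂ)) x := by
  convert (hq.rpow_const (p := p) (Or.inl hpos.ne')).ofReal_comp using 1
  rw [Real.rpow_sub_one hpos.ne']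
  push_cast
  ring

/-- The gauge transformation `Ψ := G⁻¹Φ`, `G = diag(q^{-1/4}, q^{1/4})`, takes the
Camassa-Holm matrix spectral problem `Φ_x = 𝓛Φ` to the SL(2) form
`Ψ_x + (h̃σ₃ − λ√q J)Ψ = 0` with `h̃ = 1/2 − q_x/(4q)`. -/
theorem gauge_transformed_spectral_problem (q : ℝ → ℝ) (hqpos : ∀ x, 0 < q x)
    (hq : ContDiff ℝ 1 q) (lam : ℂ) (Φ : ℝ → Fin 2 → ℂ)
    (hΦ : ∀ x, HasDerivAt Φ ((!![-(1/2 : ℂ), lam; lam * (q x : ℂ), 1/2]) *ᵥ Φ x) x)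
    (G : ℝ → Matrix (Fin 2) (Fin 2) ℂ)
    (hG : G = fun x => !![((q x ^ (-(1/4) : ℝ) : ℝ) : ℂ), 0; 0, ((q x ^ ((1/4) : ℝ) : ℝ) : ℂ)])
    (Ψ : ℝ → Fin 2 → ℂ) (hΨ : Ψ = fun x => (G x)⁻¹ *ᵥ Φ x) :
    ∀ x : ℝ,
      HasDerivAt Ψ
        (((lam * (Real.sqrt (q x) : ℂ)) • (!![0, 1; 1, 0] : Matrix (Fin 2) (Fin 2) ℂ)
          - (((1/2 - deriv q x / (4 * q x) : ℝ)) : ℂ) •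
              (!![1, 0; 0, -1] : Matrix (Fin 2) (Fin 2) ℂ)) *ᵥ Ψ x) x := by
  intro x
  have hinv : ∀ y, (G y)⁻¹ = !![((q y ^ ((1/4) : ℝ) : ℝ) : ℂ), 0;
      0, ((q y ^ (-(1/4) : ℝ) : ℝ) : ℂ)] := fun y => by
    rw [hG]
    apply inv_fin_two_diagonal
    rw [← Complex.ofReal_mul, ← Real.rpow_add (hqpos y)]
    simp
  have hq' : HasDerivAt q (deriv q x) x :=
    (hq.differentiable one_ne_zero x).hasDerivAt
  have hsqrt : Real.sqrt (q x) = q x ^ ((1/4) : ℝ) * q x ^ ((1/4) : ℝ) := by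
    rw [Real.sqrt_eq_rpow, ← Real.rpow_add (hqpos x)]
    norm_num
  have hmul : ((q x ^ ((1/4) : ℝ) : ℝ) : ℂ) * ((q x ^ (-(1/4) : ℝ) : ℝ) : ℂ) = 1 := by
    rw [← Complex.ofReal_mul, ← Real.rpow_add (hqpos x)]
    simp
  have hpow : (q x : ℂ) = ((q x ^ ((1/4) : ℝ) : ℝ) : ℂ) ^ 4 := by
    rw [← Complex.ofReal_pow, ← Real.rpow_natCast, ← Real.rpow_mul (hqpos x).le]
    norm_num
  have hplus := hasDerivAt_ofReal_rpow_const hq' (hqpos x) (1/4)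
  have hminus := hasDerivAt_ofReal_rpow_const hq' (hqpos x) (-(1/4))
  have hΦx := hasDerivAt_pi.1 (hΦ x)
  subst hΨ
  simp only [hinv]
  rw [hasDerivAt_pi, Fin.forall_fin_two, hsqrt]
  constructor
  · refine ((hplus.fun_mul (hΦx 0)).congr_deriv ?_).congr_of_eventuallyEq
      (.of_forall fun y => by simp [vecHead, vecTail])
    simp only [Matrix.mulVec, dotProduct, Fin.sum_univ_two, Matrix.sub_apply, Matrix.smul_apply,
      Matrix.of_apply, Matrix.cons_val', Matrix.cons_val_zero, Matrix.cons_val_one,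
      Matrix.cons_val_fin_one, smul_eq_mul]
    push_cast
    linear_combination -lam * ((q x ^ ((1/4) : ℝ) : ℝ) : ℂ) * Φ x 1 * hmul
  · refine ((hminus.fun_mul (hΦx 1)).congr_deriv ?_).congr_of_eventuallyEq
      (.of_forall fun y => by simp [vecHead, vecTail])
    simp only [Matrix.mulVec, dotProduct, Fin.sum_univ_two, Matrix.sub_apply, Matrix.smul_apply,
      Matrix.of_apply, Matrix.cons_val', Matrix.cons_val_zero, Matrix.cons_val_one,
      Matrix.cons_val_fin_one, smul_eq_mul]
    push_cast
    linear_combination lam * ((q x ^ ((1/4) : ℝ) : ℝ) : ℂ) ^ 3 * Φ x 0 * hmul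
      + lam * ((q x ^ (-(1/4) : ℝ) : ℝ) : ℂ) * Φ x 0 * hpow
end

section
/- Let q : ℝ → (0,∞) be smooth, λ ∈ ℂ, and let Y : ℝ → ℝ satisfy Y'(x) = √(q(x)), so that Y is a diffeomorphism onto its image. Suppose Ψ : ℝ → ℂ² satisfies Ψ_x + ((1/2 − q_x/(4q))σ₃ − λ√q J)Ψ = 0. Define Ψ̃ := Ψ ∘ Y^{-1} and q̃ := q ∘ Y^{-1} on the image of Y. Then Ψ̃ satisfies the Zakharov–Shabat equation Ψ̃_y + (h σ₃ − λJ)Ψ̃ = 0, where h(y) = 1/(2√(q̃(y))) − q̃_y(y)/(4 q̃(y)). -/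
open Matrix

/-- A left inverse of a function with continuous nonvanishing derivative `f'` has derivative
`(f' x)⁻¹` at `f x`. -/
theorem HasDerivAt.of_leftInverse_of_continuous {f f' g : ℝ → ℝ}
    (hf : ∀ x, HasDerivAt f (f' x) x) (hf' : Continuous f') (hg : Function.LeftInverse g f)
    {x : ℝ} (hx : f' x ≠ 0) : HasDerivAt g (f' x)⁻¹ (f x) :=
  ((hasStrictDerivAt_of_hasDerivAt_of_continuousAt (.of_forall hf)
    hf'.continuousAt).to_local_left_inverse hx (.of_forall hg)).hasDerivAt

/-- The change of variable `dy = √q dx` (i.e. `Y' = √q`) transforms the gauge-transformed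
Camassa-Holm spectral problem `Ψ_x + ((1/2 − q_x/(4q))σ₃ − λ√q J)Ψ = 0` into the standard
Zakharov-Shabat form `Ψ̃_y + (hσ₃ − λJ)Ψ̃ = 0` with `h = 1/(2√q̃) − q̃_y/(4q̃)`,
where `Ψ̃ = Ψ ∘ Y⁻¹` and `q̃ = q ∘ Y⁻¹` on the image of `Y`. -/
theorem change_of_variables_to_zakharov_shabat (q : ℝ → ℝ) (hqpos : ∀ x, 0 < q x)
    (hq : ContDiff ℝ (⊤ : ℕ∞) q) (lam : ℂ)
    (Y : ℝ → ℝ) (hY : ∀ x, HasDerivAt Y (Real.sqrt (q x)) x)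
    (Yinv : ℝ → ℝ) (hYinv : Function.LeftInverse Yinv Y)
    (Ψ : ℝ → Fin 2 → ℂ)
    (hΨ : ∀ x, HasDerivAt Ψ
      (((lam * (Real.sqrt (q x) : ℂ)) • (!![0, 1; 1, 0] : Matrix (Fin 2) (Fin 2) ℂ)
        - (((1/2 - deriv q x / (4 * q x) : ℝ)) : ℂ) •
            (!![1, 0; 0, -1] : Matrix (Fin 2) (Fin 2) ℂ)) *ᵥ Ψ x) x)
    (Ψt : ℝ → Fin 2 → ℂ) (hΨt : Ψt = Ψ ∘ Yinv)
    (qt : ℝ → ℝ) (hqt : qt = q ∘ Yinv) :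
    ∀ x : ℝ,
      HasDerivAt Ψt
        ((lam • (!![0, 1; 1, 0] : Matrix (Fin 2) (Fin 2) ℂ)
          - (((1/(2 * Real.sqrt (qt (Y x))) - deriv qt (Y x) / (4 * qt (Y x)) : ℝ)) : ℂ) •
              (!![1, 0; 0, -1] : Matrix (Fin 2) (Fin 2) ℂ)) *ᵥ Ψt (Y x)) (Y x) := by
  intro x
  subst hΨt hqt
  have hs : 0 < √(q x) := Real.sqrt_pos.2 (hqpos x)
  have hx : Yinv (Y x) = x := hYinv x
  have hinv : HasDerivAt Yinv (√(q x))⁻¹ (Y x) :=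
    HasDerivAt.of_leftInverse_of_continuous hY (Real.continuous_sqrt.comp hq.continuous) hYinv
      hs.ne'
  have hq' : HasDerivAt q (deriv q x) x := (hq.differentiable (by simp) x).hasDerivAt
  have hqt : deriv (q ∘ Yinv) (Y x) = deriv q x * (√(q x))⁻¹ :=
    (hq'.comp_of_eq (Y x) hinv hx.symm).deriv
  have hh : 1 / (2 * √(q x)) - deriv q x * (√(q x))⁻¹ / (4 * q x)
      = (√(q x))⁻¹ * (1 / 2 - deriv q x / (4 * q x)) := by
    have := (hqpos x).ne'
    field_simp
  have hsC : ((√(q x) : ℝ) : ℂ) ≠ 0 := Complex.ofReal_ne_zero.2 hs.ne'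
  rw [hqt]
  simp only [Function.comp_apply, hx]
  rw [hh]
  refine ((hΨ x).scomp_of_eq (Y x) hinv hx.symm).congr_deriv ?_
  rw [← Matrix.smul_mulVec]
  congr 1
  ext i j
  simp only [Matrix.sub_apply, Matrix.smul_apply, smul_eq_mul, Complex.real_smul,
    Complex.ofReal_mul, Complex.ofReal_inv]
  field_simp
end

section
/- Let ω ∈ ℝ∖{0} and A ∈ ℂ^{2×2}. Define the rational matrix functions g(λ) = I + 2iωA/(λ − iω) and ĝ(λ) = I − 2iω J Aᵀ J/(λ + iω). Then g(λ)ĝ(λ) = I for all λ ∈ ℂ∖{iω, −iω} if and only if A(I − JAᵀJ) = 0 and (I − A)JAᵀJ = 0. -/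
open Matrix

section OnePole

variable {K R : Type*} [Field K] [Ring R] [Algebra K R]

theorem one_pole_mul_sub_one {c z : K} (hz : z - c ≠ 0) (hz' : z + c ≠ 0) (A B : R) :
    (1 + (2 * c / (z - c)) • A) * (1 - (2 * c / (z + c)) • B) - 1 =
      (2 * c / ((z - c) * (z + c))) •
        ((z + c) • (A * (1 - B)) - (z - c) • ((1 - A) * B)) := by
  simp only [mul_sub, sub_mul, add_mul, mul_one, one_mul, smul_mul_smul_comm]
  match_scalars <;> field_simp <;> ring

theorem one_pole_mul_eq_one_iff [CharZero K] {c : K} (hc : c ≠ 0) (A B : R) :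
    (∀ z : K, z ≠ c → z ≠ -c →
        (1 + (2 * c / (z - c)) • A) * (1 - (2 * c / (z + c)) • B) = 1) ↔
      A * (1 - B) = 0 ∧ (1 - A) * B = 0 := by
  have key {z : K} (h₁ : z ≠ c) (h₂ : z ≠ -c) :
      (1 + (2 * c / (z - c)) • A) * (1 - (2 * c / (z + c)) • B) = 1 ↔
        (z + c) • (A * (1 - B)) - (z - c) • ((1 - A) * B) = 0 := by
    have hz : z - c ≠ 0 := sub_ne_zero.2 h₁
    have hz' : z + c ≠ 0 := fun h => h₂ (eq_neg_of_add_eq_zero_left h)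
    have h₀ : 2 * c / ((z - c) * (z + c)) ≠ 0 :=
      div_ne_zero (mul_ne_zero two_ne_zero hc) (mul_ne_zero hz hz')
    rw [← sub_eq_zero, one_pole_mul_sub_one hz hz', smul_eq_zero_iff_right h₀]
  refine ⟨fun h => ?_, fun ⟨hX, hY⟩ z h₁ h₂ => (key h₁ h₂).2 (by simp [hX, hY])⟩
  have h0 : (0 : K) ≠ c := hc.symm
  have h0' : (0 : K) ≠ -c := (neg_ne_zero.2 hc).symm
  have h2 : 2 * c ≠ c := fun e => hc (by linear_combination e)
  have h2' : 2 * c ≠ -c := fun e =>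
    mul_ne_zero three_ne_zero hc (by linear_combination e)
  have e0 := (key h0 h0').1 (h 0 h0 h0')
  have e2 := (key h2 h2').1 (h (2 * c) h2 h2')
  generalize A * (1 - B) = X at *
  generalize (1 - A) * B = Y at *
  have hX : (4 * c) • X = 0 := by
    linear_combination (norm := module) e0 + e2
  have hY : (4 * c) • Y = 0 := by
    linear_combination (norm := module) 3 • e0 - e2
  have h₀ : (4 : K) * c ≠ 0 := mul_ne_zero (by norm_num) hc
  exact ⟨(smul_eq_zero_iff_right h₀).1 hX, (smul_eq_zero_iff_right h₀).1 hY⟩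

end OnePole

/-- The one-pole dressing factor `g(λ) = I + 2iωA/(λ − iω)` satisfies
`g(λ)·(I − 2iω J Aᵀ J/(λ + iω)) = I` for all `λ ∉ {iω, −iω}` if and only if the
residue conditions `A(I − JAᵀJ) = 0` and `(I − A)JAᵀJ = 0` hold. -/
theorem one_pole_dressing_inverse_iff_residue_conditions (ω : ℝ) (hω : ω ≠ 0)
    (A : Matrix (Fin 2) (Fin 2) ℂ)
    (g ghat : ℂ → Matrix (Fin 2) (Fin 2) ℂ)
    (hg : g = fun lam => 1 + (2 * Complex.I * ω / (lam - Complex.I * ω)) • A)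
    (hghat : ghat = fun lam => 1 - (2 * Complex.I * ω / (lam + Complex.I * ω)) •
        ((!![0, 1; 1, 0] : Matrix (Fin 2) (Fin 2) ℂ) * Aᵀ
          * (!![0, 1; 1, 0] : Matrix (Fin 2) (Fin 2) ℂ))) :
    (∀ lam : ℂ, lam ≠ Complex.I * ω → lam ≠ -(Complex.I * ω) → g lam * ghat lam = 1)
      ↔ (A * (1 - (!![0, 1; 1, 0] : Matrix (Fin 2) (Fin 2) ℂ) * Aᵀ
              * (!![0, 1; 1, 0] : Matrix (Fin 2) (Fin 2) ℂ)) = 0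
          ∧ (1 - A) * ((!![0, 1; 1, 0] : Matrix (Fin 2) (Fin 2) ℂ) * Aᵀ
              * (!![0, 1; 1, 0] : Matrix (Fin 2) (Fin 2) ℂ)) = 0) := by
  subst hg hghat
  have hc : Complex.I * (ω : ℂ) ≠ 0 :=
    mul_ne_zero Complex.I_ne_zero (Complex.ofReal_ne_zero.2 hω)
  generalize (!![0, 1; 1, 0] : Matrix (Fin 2) (Fin 2) ℂ) * Aᵀ * !![0, 1; 1, 0] = B
  simp only [mul_assoc (2 : ℂ)]
  exact one_pole_mul_eq_one_iff hc A B
end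

section
/- Let ω ∈ ℝ∖{0}, let h, h₀ : ℝ → ℂ be continuous, and let A : ℝ → ℂ^{2×2} be differentiable with A(y)² = A(y) for all y. Define g(y,λ) = I + 2iωA(y)/(λ − iω). Then g satisfies g_y + hσ₃ g − g h₀σ₃ − λ[J, g] = 0 for all y and all λ ∈ ℂ∖{iω} if and only if both of the following hold for all y: (i) (h − h₀)σ₃ = 2iω[J, A], and (ii) A_y + (h₀σ₃ + iωJ)A − A(h₀σ₃ − iωJ) − 2iω A J A = 0. -/
open Matrix

attribute [local instance] Matrix.normedAddCommGroup Matrix.normedSpace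

section Algebra

variable {R : Type*} [Ring R] [Algebra ℂ R]

/-- An affine function of `c / (z - p)` vanishes identically iff both coefficients vanish. -/
theorem forall_add_div_smul_eq_zero_iff {M : Type*} [AddCommGroup M] [Module ℂ M]
    {c : ℂ} (hc : c ≠ 0) (p : ℂ) (X Y : M) :
    (∀ z : ℂ, z ≠ p → X + (c / (z - p)) • Y = 0) ↔ X = 0 ∧ Y = 0 := by
  refine ⟨fun H => ?_, fun ⟨hX, hY⟩ z _ => by simp [hX, hY]⟩
  have h₁ := H (p + c) (by simpa using hc)
  have h₂ := H (p + c / 2) (by simpa using hc)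
  have e : c / (c / 2) = 2 := by field_simp
  rw [add_sub_cancel_left, div_self hc, one_smul] at h₁
  rw [add_sub_cancel_left, e] at h₂
  have hY : Y = 0 := by
    have h₃ : Y = (X + (2 : ℂ) • Y) - (X + Y) := by module
    rw [h₃, h₂, h₁, sub_zero]
  exact ⟨by simpa [hY] using h₁, hY⟩

/-- Partial-fraction form of the dressing expression of a one-pole factor. -/
theorem dressing_expression_eq (S J A D : R) (a b c p z : ℂ) (hz : z ≠ p) :
    (c / (z - p)) • D + (a • S) * (1 + (c / (z - p)) • A)
        - (1 + (c / (z - p)) • A) * (b • S)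
        - z • (J * (1 + (c / (z - p)) • A) - (1 + (c / (z - p)) • A) * J)
      = ((a - b) • S - c • (J * A - A * J))
        + (c / (z - p)) • (D + a • (S * A) - b • (A * S) - p • (J * A - A * J)) := by
  have hz' : z - p ≠ 0 := sub_ne_zero.mpr hz
  obtain ⟨t, ht⟩ : ∃ t, t = c / (z - p) := ⟨_, rfl⟩
  have hc : c = t * (z - p) := by rw [ht, div_mul_cancel₀ _ hz']
  rw [← ht, hc]
  simp only [mul_add, add_mul, mul_one, one_mul, smul_mul_assoc, mul_smul_comm]
  module

/-- Under the residue condition at infinity, the residue of the dressing expression at the pole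
takes Riccati form when `A` is idempotent. -/
theorem dressing_residue_eq {S J A : R} (D : R) {a b p : ℂ} (hA : A * A = A)
    (hX : (a - b) • S = (2 * p) • (J * A - A * J)) :
    D + a • (S * A) - b • (A * S) - p • (J * A - A * J)
      = D + (b • S + p • J) * A - A * (b • S - p • J) - (2 * p) • (A * J * A) := by
  have h := congrArg (· * A) hX
  simp only [smul_mul_assoc, sub_mul, mul_assoc, hA] at h
  have h' : a • (S * A) = b • (S * A) + (2 * p) • (J * A - A * (J * A)) := by
    rw [← h]; module
  simp only [h', add_mul, mul_sub, smul_mul_assoc, mul_smul_comm, mul_assoc]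
  module

end Algebra

/-- For a one-pole dressing factor `g(y,λ) = I + 2iωA(y)/(λ − iω)` with projector-valued
residue (`A² = A`), the dressing equation `g_y + hσ₃g − gh₀σ₃ − λ[J,g] = 0` holds for
all `y` and all `λ ≠ iω` if and only if for all `y`:
(i) `(h − h₀)σ₃ = 2iω[J,A]` and
(ii) `A_y + (h₀σ₃ + iωJ)A − A(h₀σ₃ − iωJ) − 2iωAJA = 0`. -/
theorem one_pole_dressing_equation_iff (ω : ℝ) (hω : ω ≠ 0) (h h₀ : ℝ → ℂ)
    (hh : Continuous h) (hh₀ : Continuous h₀)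
    (A : ℝ → Matrix (Fin 2) (Fin 2) ℂ) (hA : Differentiable ℝ A)
    (hproj : ∀ y, A y * A y = A y)
    (g : ℝ → ℂ → Matrix (Fin 2) (Fin 2) ℂ)
    (hg : g = fun y lam => 1 + (2 * Complex.I * ω / (lam - Complex.I * ω)) • A y) :
    (∀ (y : ℝ) (lam : ℂ), lam ≠ Complex.I * ω →
        (2 * Complex.I * ω / (lam - Complex.I * ω)) • deriv A y
          + (h y • (!![1, 0; 0, -1] : Matrix (Fin 2) (Fin 2) ℂ)) * g y lam
          - g y lam * (h₀ y • (!![1, 0; 0, -1] : Matrix (Fin 2) (Fin 2) ℂ))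
          - lam • ((!![0, 1; 1, 0] : Matrix (Fin 2) (Fin 2) ℂ) * g y lam
              - g y lam * (!![0, 1; 1, 0] : Matrix (Fin 2) (Fin 2) ℂ)) = 0)
      ↔ (∀ y : ℝ,
          (h y - h₀ y) • (!![1, 0; 0, -1] : Matrix (Fin 2) (Fin 2) ℂ)
            = (2 * Complex.I * ω) • ((!![0, 1; 1, 0] : Matrix (Fin 2) (Fin 2) ℂ) * A y
                - A y * (!![0, 1; 1, 0] : Matrix (Fin 2) (Fin 2) ℂ))
          ∧ deriv A y
              + (h₀ y • (!![1, 0; 0, -1] : Matrix (Fin 2) (Fin 2) ℂ)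
                  + (Complex.I * ω) • (!![0, 1; 1, 0] : Matrix (Fin 2) (Fin 2) ℂ)) * A y
              - A y * (h₀ y • (!![1, 0; 0, -1] : Matrix (Fin 2) (Fin 2) ℂ)
                  - (Complex.I * ω) • (!![0, 1; 1, 0] : Matrix (Fin 2) (Fin 2) ℂ))
              - (2 * Complex.I * ω) •
                  (A y * (!![0, 1; 1, 0] : Matrix (Fin 2) (Fin 2) ℂ) * A y) = 0) := by
  subst hg
  have hc : 2 * Complex.I * (ω : ℂ) ≠ 0 := by simp [hω]
  refine forall_congr' fun y => ?_
  have key := forall_add_div_smul_eq_zero_iff hc (Complex.I * ω)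
    ((h y - h₀ y) • (!![1, 0; 0, -1] : Matrix (Fin 2) (Fin 2) ℂ)
      - (2 * Complex.I * ω) • (!![0, 1; 1, 0] * A y - A y * !![0, 1; 1, 0]))
    (deriv A y + h y • (!![1, 0; 0, -1] * A y) - h₀ y • (A y * !![1, 0; 0, -1])
      - (Complex.I * ω) • (!![0, 1; 1, 0] * A y - A y * !![0, 1; 1, 0]))
  refine (forall₂_congr fun z hz => ?_).trans (key.trans ?_)
  · rw [← dressing_expression_eq _ _ _ _ _ _ _ _ _ hz]
  · rw [sub_eq_zero, mul_assoc 2 Complex.I (ω : ℂ)]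
    refine and_congr_right fun hX => ?_
    rw [dressing_residue_eq _ (hproj y) hX]
end

section
/- Let h₀ ∈ ℂ be a constant, ω ∈ ℝ, and let m : ℝ → ℂ² be differentiable with mᵀ(y)Jm(y) ≠ 0 for all y and satisfying the bare equation m_y + (h₀σ₃ + iωJ)m = 0. Define A(y) := m(y) (m(y)ᵀJ) / (m(y)ᵀJ m(y)). Then A satisfies A_y + (h₀σ₃ + iωJ)A − A(h₀σ₃ − iωJ) − 2iω A J A = 0. -/
open Matrix

attribute [local instance] Matrix.normedAddCommGroup Matrix.normedSpace

/-- A matrix-valued function is differentiable, with the entrywise derivative, as soon as each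
entry is. -/
theorem hasDerivAt_matrix_of_entries {k l : Type*} [Fintype k] [Fintype l]
    {A : ℝ → Matrix k l ℂ} {A' : Matrix k l ℂ} {y : ℝ}
    (h : ∀ i j, HasDerivAt (fun x => A x i j) (A' i j) y) : HasDerivAt A A' y :=
  hasDerivAt_pi.2 fun i => hasDerivAt_pi.2 fun j => h i j

/-- If the vector `m` solves the bare equation `m_y + (h₀σ₃ + iωJ)m = 0` and
`mᵀJm ≠ 0`, then the rank-one projector `A = m(mᵀJ)/(mᵀJm)` solves the residue
equation `A_y + (h₀σ₃ + iωJ)A − A(h₀σ₃ − iωJ) − 2iωAJA = 0`. -/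
theorem bare_vector_solves_residue_equation (h₀ : ℂ) (ω : ℝ)
    (m : ℝ → Fin 2 → ℂ)
    (hm : ∀ y, m y ⬝ᵥ ((!![0, 1; 1, 0] : Matrix (Fin 2) (Fin 2) ℂ) *ᵥ m y) ≠ 0)
    (hode : ∀ y, HasDerivAt m
      (-((h₀ • (!![1, 0; 0, -1] : Matrix (Fin 2) (Fin 2) ℂ)
          + (Complex.I * ω) • (!![0, 1; 1, 0] : Matrix (Fin 2) (Fin 2) ℂ)) *ᵥ m y)) y)
    (A : ℝ → Matrix (Fin 2) (Fin 2) ℂ)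
    (hA : A = fun y => (m y ⬝ᵥ ((!![0, 1; 1, 0] : Matrix (Fin 2) (Fin 2) ℂ) *ᵥ m y))⁻¹ •
        vecMulVec (m y) (m y ᵥ* (!![0, 1; 1, 0] : Matrix (Fin 2) (Fin 2) ℂ))) :
    ∀ y : ℝ,
      HasDerivAt A
        (A y * (h₀ • (!![1, 0; 0, -1] : Matrix (Fin 2) (Fin 2) ℂ)
            - (Complex.I * ω) • (!![0, 1; 1, 0] : Matrix (Fin 2) (Fin 2) ℂ))
          + (2 * Complex.I * ω) •
              (A y * (!![0, 1; 1, 0] : Matrix (Fin 2) (Fin 2) ℂ) * A y)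
          - (h₀ • (!![1, 0; 0, -1] : Matrix (Fin 2) (Fin 2) ℂ)
              + (Complex.I * ω) • (!![0, 1; 1, 0] : Matrix (Fin 2) (Fin 2) ℂ)) * A y) y := by
  intro y
  have ha : HasDerivAt (fun x => m x 0) (-(h₀ * m y 0 + Complex.I * ω * m y 1)) y := by
    refine (hasDerivAt_pi.1 (hode y) 0).congr_deriv ?_
    simp [dotProduct, Fin.sum_univ_two]
  have hb : HasDerivAt (fun x => m x 1) (h₀ * m y 1 - Complex.I * ω * m y 0) y := by
    refine (hasDerivAt_pi.1 (hode y) 1).congr_deriv ?_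
    simp [dotProduct, Fin.sum_univ_two]
    ring
  have hne : ∀ x, m x 0 ≠ 0 ∧ m x 1 ≠ 0 := by
    intro x
    constructor <;> intro h <;> apply hm x <;>
      simp [mulVec, dotProduct, Fin.sum_univ_two, h]
  have hA' : A = fun x => !![1 / 2, m x 0 / m x 1 / 2; m x 1 / m x 0 / 2, 1 / 2] := by
    rw [hA]
    funext x
    obtain ⟨h0, h1⟩ := hne x
    have hq : m x ⬝ᵥ ((!![0, 1; 1, 0] : Matrix (Fin 2) (Fin 2) ℂ) *ᵥ m x)
        = 2 * m x 0 * m x 1 := by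
      simp [mulVec, dotProduct, Fin.sum_univ_two]
      ring
    rw [hq]
    ext i j
    fin_cases i <;> fin_cases j <;>
      simp <;> field_simp <;> rfl
  obtain ⟨h0, h1⟩ := hne y
  rw [hA']
  apply hasDerivAt_matrix_of_entries
  intro i j
  fin_cases i <;> fin_cases j
  · refine (hasDerivAt_const y (1 / 2 : ℂ)).congr_deriv ?_
    simp
    field_simp
    ring
  · refine ((ha.div hb h1).div_const 2).congr_deriv ?_
    simp
    field_simp
    ring
  · refine ((hb.div ha h0).div_const 2).congr_deriv ?_
    simp
    field_simp
    ring
  · refine (hasDerivAt_const y (1 / 2 : ℂ)).congr_deriv ?_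
    simp
    field_simp
    ring
end

section
/- Let h₀ > 0, 0 < Λ < h₀, c ≠ 0, and let Ω : ℝ → ℝ be differentiable with Ω'(y) = Λ for all y. Define A(y) = c e^{Ω(y)} + ((h₀+Λ)²/(h₀−Λ)) e^{−Ω(y)}, B(y) = c e^{Ω(y)} + (h₀−Λ) e^{−Ω(y)}, and T(y) = c e^{Ω(y)} + (h₀+Λ) e^{−Ω(y)}. Then the identity 2h₀ A B + A' B − A B' = 2h₀ T² holds for all y. -/
/-- The integrated form of the one-soliton ODE of the Camassa-Holm dressing
construction: with `Ω' = Λ`, `A = ce^Ω + ((h₀+Λ)²/(h₀−Λ))e^{−Ω}`,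
`B = ce^Ω + (h₀−Λ)e^{−Ω}` and `T = ce^Ω + (h₀+Λ)e^{−Ω}`, one has
`2h₀AB + A'B − AB' = 2h₀T²`. -/
theorem one_soliton_identity (h₀ Λ c : ℝ) (hh₀ : 0 < h₀) (hΛ₁ : 0 < Λ) (hΛ₂ : Λ < h₀)
    (hc : c ≠ 0)
    (Ω : ℝ → ℝ) (hΩ : ∀ y, HasDerivAt Ω Λ y)
    (A B T : ℝ → ℝ)
    (hA : A = fun y => c * Real.exp (Ω y) + ((h₀ + Λ) ^ 2 / (h₀ - Λ)) * Real.exp (-(Ω y)))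
    (hB : B = fun y => c * Real.exp (Ω y) + (h₀ - Λ) * Real.exp (-(Ω y)))
    (hT : T = fun y => c * Real.exp (Ω y) + (h₀ + Λ) * Real.exp (-(Ω y))) :
    ∀ y : ℝ,
      2 * h₀ * A y * B y + deriv A y * B y - A y * deriv B y = 2 * h₀ * T y ^ 2 := by
  intro y
  have hne : h₀ - Λ ≠ 0 := (sub_pos.mpr hΛ₂).ne'
  have hderiv (a : ℝ) :
      deriv (fun y => c * Real.exp (Ω y) + a * Real.exp (-(Ω y))) y =
        c * (Real.exp (Ω y) * Λ) + a * (Real.exp (-(Ω y)) * -Λ) :=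
    (((hΩ y).exp.const_mul c).add ((hΩ y).neg.exp.const_mul a)).deriv
  have hdiv : (h₀ + Λ) ^ 2 / (h₀ - Λ) * (h₀ - Λ) = (h₀ + Λ) ^ 2 := div_mul_cancel₀ _ hne
  rw [hA, hB, hT, hderiv, hderiv]
  generalize (h₀ + Λ) ^ 2 / (h₀ - Λ) = a at hdiv ⊢
  beta_reduce
  generalize Real.exp (Ω y) = E
  generalize Real.exp (-(Ω y)) = F
  linear_combination (2 * h₀ * F ^ 2 + 2 * c * E * F) * hdiv
end

section
/- Let ω₁, ω₂ be distinct nonzero reals with ω₁ + ω₂ ≠ 0, set η₁ = 2ω₁/(ω₁+ω₂) and η₂ = 2ω₂/(ω₁+ω₂), and let A₁, A₂ ∈ ℂ^{2×2}. Define g(λ) = I + 2iω₁A₁/(λ − iω₁) + 2iω₂A₂/(λ − iω₂) and ĝ(λ) = I − 2iω₁JA₁ᵀJ/(λ + iω₁) − 2iω₂JA₂ᵀJ/(λ + iω₂). If g(λ)ĝ(λ) = I for all λ ∈ ℂ∖{±iω₁, ±iω₂}, then A₁(I − JA₁ᵀJ − η₂ JA₂ᵀJ) = 0 and A₂(I −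 η₁ JA₁ᵀJ − JA₂ᵀJ) = 0. -/
open Matrix

open Topology in
/-- If a matrix-valued function with a simple pole at `a`, with residue `c • A`, has a right
inverse `G` near `a` which is continuous at `a`, then `A * G a = 0`. -/
theorem mul_eq_zero_of_simple_pole_mul_eq_one {n : Type*} [Fintype n] [DecidableEq n]
    {a c : ℂ} (hc : c ≠ 0) {A : Matrix n n ℂ} {R G : ℂ → Matrix n n ℂ}
    (hR : ContinuousAt R a) (hG : ContinuousAt G a)
    (h : ∀ᶠ z in 𝓝[≠] a, ((c / (z - a)) • A + R z) * G z = 1) : A * G a = 0 := by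
  have hlim : ContinuousAt (fun z => (c • A + (z - a) • R z) * G z) a := by fun_prop
  have hlim' : ContinuousAt (fun z : ℂ => (z - a) • (1 : Matrix n n ℂ)) a := by fun_prop
  have heq : (fun z => (c • A + (z - a) • R z) * G z) =ᶠ[𝓝[≠] a]
      fun z => (z - a) • (1 : Matrix n n ℂ) := by
    filter_upwards [h, self_mem_nhdsWithin] with z hz hza
    have hza' : z - a ≠ 0 := sub_ne_zero.mpr hza
    rw [← hz, ← Matrix.smul_mul, smul_add, smul_smul, mul_div_cancel₀ _ hza']
  have key := tendsto_nhds_unique_of_eventuallyEq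
    (hlim.tendsto.mono_left nhdsWithin_le_nhds) (hlim'.tendsto.mono_left nhdsWithin_le_nhds) heq
  simpa [hc] using key

/-- Residue conditions for the inverse of a two-pole dressing factor: if
`g(λ) = I + 2iω₁A₁/(λ−iω₁) + 2iω₂A₂/(λ−iω₂)` satisfies `g(λ)·ĝ(λ) = I` with
`ĝ(λ) = I − 2iω₁JA₁ᵀJ/(λ+iω₁) − 2iω₂JA₂ᵀJ/(λ+iω₂)` for all `λ ∉ {±iω₁, ±iω₂}`, then
`A₁(I − JA₁ᵀJ − η₂JA₂ᵀJ) = 0` and `A₂(I − η₁JA₁ᵀJ − JA₂ᵀJ) = 0`, where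
`ηₖ = 2ωₖ/(ω₁+ω₂)`. -/
theorem two_pole_residue_conditions (ω₁ ω₂ : ℝ) (h₁ : ω₁ ≠ 0) (h₂ : ω₂ ≠ 0)
    (h₁₂ : ω₁ ≠ ω₂) (hsum : ω₁ + ω₂ ≠ 0)
    (η₁ η₂ : ℂ) (hη₁ : η₁ = 2 * ω₁ / (ω₁ + ω₂)) (hη₂ : η₂ = 2 * ω₂ / (ω₁ + ω₂))
    (A₁ A₂ : Matrix (Fin 2) (Fin 2) ℂ)
    (g ghat : ℂ → Matrix (Fin 2) (Fin 2) ℂ)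
    (hg : g = fun lam => 1 + (2 * Complex.I * ω₁ / (lam - Complex.I * ω₁)) • A₁
        + (2 * Complex.I * ω₂ / (lam - Complex.I * ω₂)) • A₂)
    (hghat : ghat = fun lam =>
        1 - (2 * Complex.I * ω₁ / (lam + Complex.I * ω₁)) •
              ((!![0, 1; 1, 0] : Matrix (Fin 2) (Fin 2) ℂ) * A₁ᵀ
                * (!![0, 1; 1, 0] : Matrix (Fin 2) (Fin 2) ℂ))
          - (2 * Complex.I * ω₂ / (lam + Complex.I * ω₂)) •
              ((!![0, 1; 1, 0] : Matrix (Fin 2) (Fin 2) ℂ) * A₂ᵀ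
                * (!![0, 1; 1, 0] : Matrix (Fin 2) (Fin 2) ℂ)))
    (hinv : ∀ lam : ℂ, lam ≠ Complex.I * ω₁ → lam ≠ -(Complex.I * ω₁) →
        lam ≠ Complex.I * ω₂ → lam ≠ -(Complex.I * ω₂) → g lam * ghat lam = 1) :
    A₁ * (1 - (!![0, 1; 1, 0] : Matrix (Fin 2) (Fin 2) ℂ) * A₁ᵀ
            * (!![0, 1; 1, 0] : Matrix (Fin 2) (Fin 2) ℂ)
          - η₂ • ((!![0, 1; 1, 0] : Matrix (Fin 2) (Fin 2) ℂ) * A₂ᵀ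
            * (!![0, 1; 1, 0] : Matrix (Fin 2) (Fin 2) ℂ))) = 0
    ∧ A₂ * (1 - η₁ • ((!![0, 1; 1, 0] : Matrix (Fin 2) (Fin 2) ℂ) * A₁ᵀ
            * (!![0, 1; 1, 0] : Matrix (Fin 2) (Fin 2) ℂ))
          - (!![0, 1; 1, 0] : Matrix (Fin 2) (Fin 2) ℂ) * A₂ᵀ
            * (!![0, 1; 1, 0] : Matrix (Fin 2) (Fin 2) ℂ)) = 0 := by
  have hI := Complex.I_ne_zero
  have h₁' : (ω₁ : ℂ) ≠ 0 := by exact_mod_cast h₁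
  have h₂' : (ω₂ : ℂ) ≠ 0 := by exact_mod_cast h₂
  have h₁₂' : (ω₁ : ℂ) ≠ ω₂ := by exact_mod_cast h₁₂
  have hsum' : (ω₁ : ℂ) + ω₂ ≠ 0 := by exact_mod_cast hsum
  have add_ne {x y : ℂ} (h : x + y ≠ 0) : Complex.I * x + Complex.I * y ≠ 0 := by
    rw [← mul_add]; exact mul_ne_zero hI h
  have sub_ne {x y : ℂ} (h : x ≠ y) : Complex.I * x - Complex.I * y ≠ 0 := by
    rw [← mul_sub]; exact mul_ne_zero hI (sub_ne_zero.mpr h)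
  have n₁₁ := add_ne (x := ω₁) (y := ω₁) (by simpa using h₁')
  have n₂₂ := add_ne (x := ω₂) (y := ω₂) (by simpa using h₂')
  have n₁₂ := add_ne hsum'
  have n₂₁ := add_ne (x := ω₂) (y := ω₁) (by rwa [add_comm])
  have m₁₂ := sub_ne h₁₂'
  have m₂₁ := sub_ne h₁₂'.symm
  constructor
  · have hG : ContinuousAt ghat (Complex.I * ω₁) := by
      rw [hghat]; fun_prop (disch := assumption)
    have key := mul_eq_zero_of_simple_pole_mul_eq_one (a := Complex.I * ω₁)
      (c := 2 * Complex.I * ω₁) (A := A₁)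
      (R := fun z => 1 + (2 * Complex.I * ω₂ / (z - Complex.I * ω₂)) • A₂)
      (by simp [h₁]) (by fun_prop (disch := assumption)) hG (by
        filter_upwards [self_mem_nhdsWithin,
          nhdsWithin_le_nhds (eventually_ne_nhds (sub_ne_zero.mp m₁₂)),
          nhdsWithin_le_nhds (eventually_ne_nhds (mt eq_neg_iff_add_eq_zero.mp n₁₁)),
          nhdsWithin_le_nhds (eventually_ne_nhds (mt eq_neg_iff_add_eq_zero.mp n₁₂))]
          with z hz₁ hz₂ hz₃ hz₄
        convert hinv z hz₁ hz₃ hz₂ hz₄ using 2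
        simp only [hg]
        abel)
    have e₁ : 2 * Complex.I * ω₁ / (Complex.I * ω₁ + Complex.I * ω₁) = 1 := by
      rw [div_eq_one_iff_eq n₁₁]; ring
    have e₂ : 2 * Complex.I * ω₂ / (Complex.I * ω₁ + Complex.I * ω₂) = η₂ := by
      rw [hη₂, div_eq_div_iff n₁₂ hsum']; ring
    simpa only [hghat, e₁, e₂, one_smul] using key
  · have hG : ContinuousAt ghat (Complex.I * ω₂) := by
      rw [hghat]; fun_prop (disch := assumption)
    have key := mul_eq_zero_of_simple_pole_mul_eq_one (a := Complex.I * ω₂)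
      (c := 2 * Complex.I * ω₂) (A := A₂)
      (R := fun z => 1 + (2 * Complex.I * ω₁ / (z - Complex.I * ω₁)) • A₁)
      (by simp [h₂]) (by fun_prop (disch := assumption)) hG (by
        filter_upwards [self_mem_nhdsWithin,
          nhdsWithin_le_nhds (eventually_ne_nhds (sub_ne_zero.mp m₂₁)),
          nhdsWithin_le_nhds (eventually_ne_nhds (mt eq_neg_iff_add_eq_zero.mp n₂₁)),
          nhdsWithin_le_nhds (eventually_ne_nhds (mt eq_neg_iff_add_eq_zero.mp n₂₂))]
          with z hz₂ hz₁ hz₃ hz₄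
        convert hinv z hz₁ hz₃ hz₂ hz₄ using 2
        simp only [hg]
        abel)
    have e₁ : 2 * Complex.I * ω₁ / (Complex.I * ω₂ + Complex.I * ω₁) = η₁ := by
      rw [hη₁, div_eq_div_iff n₂₁ hsum']; ring
    have e₂ : 2 * Complex.I * ω₂ / (Complex.I * ω₂ + Complex.I * ω₂) = 1 := by
      rw [div_eq_one_iff_eq n₂₂]; ring
    simpa only [hghat, e₁, e₂, one_smul] using key
end

section
/- Let η₁, η₂ ∈ ℂ and m, M ∈ ℂ², and define Δ := (mᵀJm)(MᵀJM) − η₁η₂(mᵀJM)². Assume Δ ≠ 0 and define the vectors n := (1/Δ)((MᵀJM) Jm − η₂ (mᵀJM) JM) and N := (1/Δ)((mᵀJm) JM − η₁ (MᵀJm) Jm). Then n and N solve the linear system mᵀ = (mᵀJm)(nᵀJ) + η₂ (mᵀJM)(NᵀJ) and Mᵀ = η₁ (MᵀJm)(nᵀJ) + (MᵀJM)(NᵀJ). -/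
open Matrix

/-- The explicit vectors `n`, `N` solve the linear system arising from the residue
conditions of the two-pole dressing factor:
`mᵀ = (mᵀJm)(nᵀJ) + η₂(mᵀJM)(NᵀJ)` and `Mᵀ = η₁(MᵀJm)(nᵀJ) + (MᵀJM)(NᵀJ)`,
where `Δ = (mᵀJm)(MᵀJM) − η₁η₂(mᵀJM)² ≠ 0`. -/
theorem two_pole_linear_system_solution (η₁ η₂ : ℂ) (m M : Fin 2 → ℂ)
    (Δ : ℂ)
    (hΔdef : Δ = (m ⬝ᵥ ((!![0, 1; 1, 0] : Matrix (Fin 2) (Fin 2) ℂ) *ᵥ m))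
        * (M ⬝ᵥ ((!![0, 1; 1, 0] : Matrix (Fin 2) (Fin 2) ℂ) *ᵥ M))
      - η₁ * η₂ * (m ⬝ᵥ ((!![0, 1; 1, 0] : Matrix (Fin 2) (Fin 2) ℂ) *ᵥ M)) ^ 2)
    (hΔ : Δ ≠ 0)
    (n N : Fin 2 → ℂ)
    (hn : n = Δ⁻¹ • ((M ⬝ᵥ ((!![0, 1; 1, 0] : Matrix (Fin 2) (Fin 2) ℂ) *ᵥ M)) •
          ((!![0, 1; 1, 0] : Matrix (Fin 2) (Fin 2) ℂ) *ᵥ m)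
        - (η₂ * (m ⬝ᵥ ((!![0, 1; 1, 0] : Matrix (Fin 2) (Fin 2) ℂ) *ᵥ M))) •
          ((!![0, 1; 1, 0] : Matrix (Fin 2) (Fin 2) ℂ) *ᵥ M)))
    (hN : N = Δ⁻¹ • ((m ⬝ᵥ ((!![0, 1; 1, 0] : Matrix (Fin 2) (Fin 2) ℂ) *ᵥ m)) •
          ((!![0, 1; 1, 0] : Matrix (Fin 2) (Fin 2) ℂ) *ᵥ M)
        - (η₁ * (M ⬝ᵥ ((!![0, 1; 1, 0] : Matrix (Fin 2) (Fin 2) ℂ) *ᵥ m))) •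
          ((!![0, 1; 1, 0] : Matrix (Fin 2) (Fin 2) ℂ) *ᵥ m))) :
    m = (m ⬝ᵥ ((!![0, 1; 1, 0] : Matrix (Fin 2) (Fin 2) ℂ) *ᵥ m)) •
          (n ᵥ* (!![0, 1; 1, 0] : Matrix (Fin 2) (Fin 2) ℂ))
        + (η₂ * (m ⬝ᵥ ((!![0, 1; 1, 0] : Matrix (Fin 2) (Fin 2) ℂ) *ᵥ M))) •
          (N ᵥ* (!![0, 1; 1, 0] : Matrix (Fin 2) (Fin 2) ℂ))
    ∧ M = (η₁ * (M ⬝ᵥ ((!![0, 1; 1, 0] : Matrix (Fin 2) (Fin 2) ℂ) *ᵥ m))) •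
          (n ᵥ* (!![0, 1; 1, 0] : Matrix (Fin 2) (Fin 2) ℂ))
        + (M ⬝ᵥ ((!![0, 1; 1, 0] : Matrix (Fin 2) (Fin 2) ℂ) *ᵥ M)) •
          (N ᵥ* (!![0, 1; 1, 0] : Matrix (Fin 2) (Fin 2) ℂ)) := by
  have h : Δ * Δ⁻¹ = 1 := mul_inv_cancel₀ hΔ
  simp only [mulVec, dotProduct, Fin.sum_univ_two, of_apply, cons_val_zero, cons_val_one,
    cons_val'] at hΔdef
  subst hn hN
  constructor <;> ext i <;> fin_cases i <;>
    simp [mulVec, dotProduct, Fin.sum_univ_two]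
  · linear_combination (-m 0) * h + Δ⁻¹ * m 0 * hΔdef
  · linear_combination (-m 1) * h + Δ⁻¹ * m 1 * hΔdef
  · linear_combination (-M 0) * h + Δ⁻¹ * M 0 * hΔdef
  · linear_combination (-M 1) * h + Δ⁻¹ * M 1 * hΔdef
end

section
/- Let ω₁, ω₂ be distinct nonzero complex numbers with ω₁ + ω₂ ≠ 0, η₁ = 2ω₁/(ω₁+ω₂), η₂ = 2ω₂/(ω₁+ω₂), and let m = (m₁,m₂), M = (M₁,M₂) ∈ ℂ² be such that Δ := (2m₁m₂)(2M₁M₂) − η₁η₂(m₁M₂+m₂M₁)² ≠ 0 and ω₁m₁M₂ − ω₂m₂M₁ ≠ 0 and ω₁m₂M₁ − ω₂m₁M₂ ≠ 0. Define n := (1/Δ)((MᵀJM) Jm − η₂ (mᵀJM) JM), N := (1/Δ)((mᵀJm) JM − η₁ (MᵀJm) Jm), and the rank-one matrices A₁ = n mᵀ, A₂ = N Mᵀ. Then I − 2(A₁ + A₂) is diagonal and equals diag( (ω₁m₂M₁ − ω₂m₁M₂)/(ω₁m₁M₂ − ω₂m₂M₁), (ω₁m₁M₂ − ω₂m₂M₁)/(ω₁m₂M₁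 − ω₂m₁M₂) ). -/
open Matrix

/-- The value at `λ = 0` of the two-pole dressing factor: with rank-one residues
`A₁ = n mᵀ`, `A₂ = N Mᵀ` built from the solution `n, N` of the residue linear system,
the matrix `I − 2(A₁ + A₂)` is diagonal and equals
`diag((ω₁m₂M₁ − ω₂m₁M₂)/(ω₁m₁M₂ − ω₂m₂M₁), (ω₁m₁M₂ − ω₂m₂M₁)/(ω₁m₂M₁ − ω₂m₁M₂))`. -/
theorem two_pole_dressing_factor_at_zero (ω₁ ω₂ : ℂ) (h₁ : ω₁ ≠ 0) (h₂ : ω₂ ≠ 0)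
    (h₁₂ : ω₁ ≠ ω₂) (hsum : ω₁ + ω₂ ≠ 0)
    (η₁ η₂ : ℂ) (hη₁ : η₁ = 2 * ω₁ / (ω₁ + ω₂)) (hη₂ : η₂ = 2 * ω₂ / (ω₁ + ω₂))
    (m M : Fin 2 → ℂ) (Δ : ℂ)
    (hΔdef : Δ = (2 * m 0 * m 1) * (2 * M 0 * M 1)
        - η₁ * η₂ * (m 0 * M 1 + m 1 * M 0) ^ 2)
    (hΔ : Δ ≠ 0)
    (hd₁ : ω₁ * m 0 * M 1 - ω₂ * m 1 * M 0 ≠ 0)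
    (hd₂ : ω₁ * m 1 * M 0 - ω₂ * m 0 * M 1 ≠ 0)
    (n N : Fin 2 → ℂ)
    (hn : n = Δ⁻¹ • ((M ⬝ᵥ ((!![0, 1; 1, 0] : Matrix (Fin 2) (Fin 2) ℂ) *ᵥ M)) •
          ((!![0, 1; 1, 0] : Matrix (Fin 2) (Fin 2) ℂ) *ᵥ m)
        - (η₂ * (m ⬝ᵥ ((!![0, 1; 1, 0] : Matrix (Fin 2) (Fin 2) ℂ) *ᵥ M))) •
          ((!![0, 1; 1, 0] : Matrix (Fin 2) (Fin 2) ℂ) *ᵥ M)))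
    (hN : N = Δ⁻¹ • ((m ⬝ᵥ ((!![0, 1; 1, 0] : Matrix (Fin 2) (Fin 2) ℂ) *ᵥ m)) •
          ((!![0, 1; 1, 0] : Matrix (Fin 2) (Fin 2) ℂ) *ᵥ M)
        - (η₁ * (M ⬝ᵥ ((!![0, 1; 1, 0] : Matrix (Fin 2) (Fin 2) ℂ) *ᵥ m))) •
          ((!![0, 1; 1, 0] : Matrix (Fin 2) (Fin 2) ℂ) *ᵥ m)))
    (A₁ A₂ : Matrix (Fin 2) (Fin 2) ℂ)
    (hA₁ : A₁ = vecMulVec n m) (hA₂ : A₂ = vecMulVec N M) :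
    (1 : Matrix (Fin 2) (Fin 2) ℂ) - 2 • (A₁ + A₂)
      = !![(ω₁ * m 1 * M 0 - ω₂ * m 0 * M 1) / (ω₁ * m 0 * M 1 - ω₂ * m 1 * M 0), 0;
           0, (ω₁ * m 0 * M 1 - ω₂ * m 1 * M 0) / (ω₁ * m 1 * M 0 - ω₂ * m 0 * M 1)] := by
  have hΔ' : Δ = 4 * (ω₁ * m 0 * M 1 - ω₂ * m 1 * M 0) * (ω₁ * m 1 * M 0 - ω₂ * m 0 * M 1)
      / (ω₁ + ω₂) ^ 2 := by
    rw [hΔdef, hη₁, hη₂]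
    field_simp
    ring
  have hη : η₂ = 2 - η₁ := by
    rw [hη₁, hη₂]
    field_simp
    ring
  have hn₀ : n 0 = Δ⁻¹ * (2 * M 0 * M 1 * m 1 - η₂ * (m 0 * M 1 + m 1 * M 0) * M 1) := by
    simp [hn, dotProduct, Fin.sum_univ_two, -mul_eq_mul_left_iff]
    ring
  have hn₁ : n 1 = Δ⁻¹ * (2 * M 0 * M 1 * m 0 - η₂ * (m 0 * M 1 + m 1 * M 0) * M 0) := by
    simp [hn, dotProduct, Fin.sum_univ_two, -mul_eq_mul_left_iff]
    ring
  have hN₀ : N 0 = Δ⁻¹ * (2 * m 0 * m 1 * M 1 - η₁ * (m 0 * M 1 + m 1 * M 0) * m 1) := by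
    simp [hN, dotProduct, Fin.sum_univ_two, -mul_eq_mul_left_iff]
    ring
  have hN₁ : N 1 = Δ⁻¹ * (2 * m 0 * m 1 * M 0 - η₁ * (m 0 * M 1 + m 1 * M 0) * m 0) := by
    simp [hN, dotProduct, Fin.sum_univ_two, -mul_eq_mul_left_iff]
    ring
  have hd₂' : ω₁ * m 1 * M 0 - m 0 * M 1 * ω₂ ≠ 0 := by
    convert hd₂ using 2
    ring
  rw [two_nsmul, hA₁, hA₂]
  ext i j
  fin_cases i <;> fin_cases j <;>
    simp [vecMulVec_apply, hn₀, hn₁, hN₀, hN₁]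
  · rw [hΔ', hη₁, hη₂]
    field_simp
    ring
  · rw [hη]
    ring
  · rw [hη]
    ring
  · rw [hΔ', hη₁, hη₂]
    field_simp
    ring
end

section
/- Let h₀ > 0, let Λ₁, Λ₂ ∈ (0, h₀) be distinct, set S = Λ₁ + Λ₂, D = Λ₂ − Λ₁, n_k = ((h₀+Λ_k)/(h₀−Λ_k))^{1/4} for k = 1,2, and let Ω₁, Ω₂ : ℝ → ℝ be differentiable with Ω_k'(y) = Λ_k. Define A(y) = e^{Ω₁+Ω₂}/(n₁³n₂³S) + n₁³n₂³ e^{−Ω₁−Ω₂}/S + (n₂³/n₁³) e^{Ω₁−Ω₂}/D + (n₁³/n₂³) e^{−Ω₁+Ω₂}/D, B(y) = n₁n₂ e^{Ω₁+Ω₂}/S + e^{−Ω₁−Ω₂}/(n₁n₂S) + (n₁/n₂) e^{Ω₁−Ω₂}/D + (n₂/n₁) e^{−Ω₁+Ω₂}/D, and T(y) = e^{Ω₁+Ω₂}/(n₁n₂S) + n₁n₂ e^{−Ω₁−Ω₂}/S + (n₂/n₁) e^{Ω₁−Ω₂}/D + (n₁/n₂) e^{−Ω₁+Ω₂}/D.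 Then the identity 2h₀ A B + A' B − A B' = 2h₀ T² holds for all y. -/
/-- The algebraic core of the two-soliton identity: `X` and `Y` play the roles of `exp Ω₁`
and `exp Ω₂`, and the fourth-power relations tie `p`, `q` to the spectral parameters. -/
theorem two_soliton_algebraic_identity {h a b p q X Y : ℝ} (hp : p ≠ 0) (hq : q ≠ 0)
    (hX : X ≠ 0) (hY : Y ≠ 0) (hS : a + b ≠ 0) (hD : b - a ≠ 0)
    (ha : p ^ 4 * (h - a) = h + a) (hb : q ^ 4 * (h - b) = h + b) :
    2 * h * (X * Y / (p ^ 3 * q ^ 3 * (a + b)) + p ^ 3 * q ^ 3 * (X⁻¹ * Y⁻¹) / (a + b)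
          + q ^ 3 / p ^ 3 * (X * Y⁻¹) / (b - a) + p ^ 3 / q ^ 3 * (X⁻¹ * Y) / (b - a))
        * (p * q * (X * Y) / (a + b) + X⁻¹ * Y⁻¹ / (p * q * (a + b))
          + p / q * (X * Y⁻¹) / (b - a) + q / p * (X⁻¹ * Y) / (b - a))
      + (X * Y * (a + b) / (p ^ 3 * q ^ 3 * (a + b))
          + p ^ 3 * q ^ 3 * (X⁻¹ * Y⁻¹ * (-a - b)) / (a + b)
          + q ^ 3 / p ^ 3 * (X * Y⁻¹ * (a - b)) / (b - a)
          + p ^ 3 / q ^ 3 * (X⁻¹ * Y * (-a + b)) / (b - a))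
        * (p * q * (X * Y) / (a + b) + X⁻¹ * Y⁻¹ / (p * q * (a + b))
          + p / q * (X * Y⁻¹) / (b - a) + q / p * (X⁻¹ * Y) / (b - a))
      - (X * Y / (p ^ 3 * q ^ 3 * (a + b)) + p ^ 3 * q ^ 3 * (X⁻¹ * Y⁻¹) / (a + b)
          + q ^ 3 / p ^ 3 * (X * Y⁻¹) / (b - a) + p ^ 3 / q ^ 3 * (X⁻¹ * Y) / (b - a))
        * (p * q * (X * Y * (a + b)) / (a + b)
          + X⁻¹ * Y⁻¹ * (-a - b) / (p * q * (a + b))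
          + p / q * (X * Y⁻¹ * (a - b)) / (b - a)
          + q / p * (X⁻¹ * Y * (-a + b)) / (b - a))
      = 2 * h * (X * Y / (p * q * (a + b)) + p * q * (X⁻¹ * Y⁻¹) / (a + b)
          + q / p * (X * Y⁻¹) / (b - a) + p / q * (X⁻¹ * Y) / (b - a)) ^ 2 := by
  have ha' : a = h * (p ^ 4 - 1) / (p ^ 4 + 1) := by
    rw [eq_div_iff (by positivity)]
    linear_combination -ha
  have hb' : b = h * (q ^ 4 - 1) / (q ^ 4 + 1) := by
    rw [eq_div_iff (by positivity)]
    linear_combination -hb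
  have hS' : a + b = 2 * h * (p ^ 4 * q ^ 4 - 1) / ((p ^ 4 + 1) * (q ^ 4 + 1)) := by
    rw [ha', hb']
    field_simp
    ring
  have hD' : b - a = 2 * h * (q ^ 4 - p ^ 4) / ((p ^ 4 + 1) * (q ^ 4 + 1)) := by
    rw [ha', hb']
    field_simp
    ring
  have hh : h ≠ 0 := by
    rintro rfl
    simp [hS'] at hS
  have hPQ : p ^ 4 * q ^ 4 - 1 ≠ 0 := by
    intro h0
    simp [hS', h0] at hS
  have hQP : q ^ 4 - p ^ 4 ≠ 0 := by
    intro h0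
    simp [hD', h0] at hD
  have hp1 : p ^ 4 + 1 ≠ 0 := by positivity
  have hq1 : q ^ 4 + 1 ≠ 0 := by positivity
  rw [show -a - b = -(a + b) by ring, show a - b = -(b - a) by ring,
    show -a + b = b - a by ring, hS', hD']
  clear ha hb ha' hb' hS' hD' hS hD
  field_simp
  ring

/-- A positive base raised to `1 / 4` satisfies the cleared fourth-power relation. -/
theorem rpow_quarter_pow_four_mul {h a : ℝ} (ha : a ∈ Set.Ioo 0 h) :
    (((h + a) / (h - a)) ^ ((1 : ℝ) / 4)) ^ 4 * (h - a) = h + a := by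
  have hsub : 0 < h - a := sub_pos.mpr ha.2
  have hadd : 0 < h + a := by linarith [ha.1, ha.2]
  rw [← Real.rpow_natCast, ← Real.rpow_mul (by positivity)]
  norm_num
  field_simp

/-- The integrated form of the two-soliton ODE of the Camassa-Holm dressing
construction: with `Ωₖ' = Λₖ`, `S = Λ₁ + Λ₂`, `D = Λ₂ − Λ₁`,
`nₖ = ((h₀+Λₖ)/(h₀−Λₖ))^{1/4}`, and `A`, `B`, `T` the indicated exponential sums,
the identity `2h₀AB + A'B − AB' = 2h₀T²` holds. -/
theorem two_soliton_identity (h₀ : ℝ) (hh₀ : 0 < h₀)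
    (Λ₁ Λ₂ : ℝ) (hΛ₁ : Λ₁ ∈ Set.Ioo 0 h₀) (hΛ₂ : Λ₂ ∈ Set.Ioo 0 h₀) (hne : Λ₁ ≠ Λ₂)
    (S D n₁ n₂ : ℝ) (hS : S = Λ₁ + Λ₂) (hD : D = Λ₂ - Λ₁)
    (hn₁ : n₁ = ((h₀ + Λ₁) / (h₀ - Λ₁)) ^ ((1 : ℝ) / 4))
    (hn₂ : n₂ = ((h₀ + Λ₂) / (h₀ - Λ₂)) ^ ((1 : ℝ) / 4))
    (Ω₁ Ω₂ : ℝ → ℝ) (hΩ₁ : ∀ y, HasDerivAt Ω₁ Λ₁ y) (hΩ₂ : ∀ y, HasDerivAt Ω₂ Λ₂ y)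
    (A B T : ℝ → ℝ)
    (hA : A = fun y => Real.exp (Ω₁ y + Ω₂ y) / (n₁ ^ 3 * n₂ ^ 3 * S)
        + n₁ ^ 3 * n₂ ^ 3 * Real.exp (-(Ω₁ y) - Ω₂ y) / S
        + (n₂ ^ 3 / n₁ ^ 3) * Real.exp (Ω₁ y - Ω₂ y) / D
        + (n₁ ^ 3 / n₂ ^ 3) * Real.exp (-(Ω₁ y) + Ω₂ y) / D)
    (hB : B = fun y => n₁ * n₂ * Real.exp (Ω₁ y + Ω₂ y) / S
        + Real.exp (-(Ω₁ y) - Ω₂ y) / (n₁ * n₂ * S)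
        + (n₁ / n₂) * Real.exp (Ω₁ y - Ω₂ y) / D
        + (n₂ / n₁) * Real.exp (-(Ω₁ y) + Ω₂ y) / D)
    (hT : T = fun y => Real.exp (Ω₁ y + Ω₂ y) / (n₁ * n₂ * S)
        + n₁ * n₂ * Real.exp (-(Ω₁ y) - Ω₂ y) / S
        + (n₂ / n₁) * Real.exp (Ω₁ y - Ω₂ y) / D
        + (n₁ / n₂) * Real.exp (-(Ω₁ y) + Ω₂ y) / D) :
    ∀ y : ℝ,
      2 * h₀ * A y * B y + deriv A y * B y - A y * deriv B y = 2 * h₀ * T y ^ 2 := by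
  have hp : n₁ ≠ 0 := by
    rw [hn₁]
    exact (Real.rpow_pos_of_pos (div_pos (by linarith [hΛ₁.1]) (sub_pos.mpr hΛ₁.2)) _).ne'
  have hq : n₂ ≠ 0 := by
    rw [hn₂]
    exact (Real.rpow_pos_of_pos (div_pos (by linarith [hΛ₂.1]) (sub_pos.mpr hΛ₂.2)) _).ne'
  have hr₁ : n₁ ^ 4 * (h₀ - Λ₁) = h₀ + Λ₁ := hn₁ ▸ rpow_quarter_pow_four_mul hΛ₁
  have hr₂ : n₂ ^ 4 * (h₀ - Λ₂) = h₀ + Λ₂ := hn₂ ▸ rpow_quarter_pow_four_mul hΛ₂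
  intro y
  have e₁ := ((hΩ₁ y).add (hΩ₂ y)).exp
  have e₂ := ((hΩ₁ y).neg.sub (hΩ₂ y)).exp
  have e₃ := ((hΩ₁ y).sub (hΩ₂ y)).exp
  have e₄ := ((hΩ₁ y).neg.add (hΩ₂ y)).exp
  have dA := (((e₁.div_const (n₁ ^ 3 * n₂ ^ 3 * S)).add
    ((e₂.const_mul (n₁ ^ 3 * n₂ ^ 3)).div_const S)).add
    ((e₃.const_mul (n₂ ^ 3 / n₁ ^ 3)).div_const D)).add
    ((e₄.const_mul (n₁ ^ 3 / n₂ ^ 3)).div_const D)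
  have dB := ((((e₁.const_mul (n₁ * n₂)).div_const S).add
    (e₂.div_const (n₁ * n₂ * S))).add
    ((e₃.const_mul (n₁ / n₂)).div_const D)).add
    ((e₄.const_mul (n₂ / n₁)).div_const D)
  rw [(dA.congr_of_eventuallyEq (f₁ := A) (.of_eq hA)).deriv,
    (dB.congr_of_eventuallyEq (f₁ := B) (.of_eq hB)).deriv, hA, hB, hT, hS, hD]
  simp only [Pi.add_apply, Pi.sub_apply, Pi.neg_apply, sub_eq_add_neg (-(Ω₁ y)),
    sub_eq_add_neg (Ω₁ y), Real.exp_add, Real.exp_neg]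
  exact two_soliton_algebraic_identity hp hq (Real.exp_ne_zero _) (Real.exp_ne_zero _)
    (by linarith [hΛ₁.1, hΛ₂.1] : 0 < Λ₁ + Λ₂).ne' (sub_ne_zero.mpr hne.symm) hr₁ hr₂
end
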